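/- Let k ≥ 1 and Δ ≥ 3, and let G be a graph with maximum degree at most Δ that contains no linear forest with k+1 edges as a subgraph. Then G has at most k(Δ-1) edges. -/

import Mathlib

open SimpleGraph

/-- The degree of a vertex `v` in a graph `G` (as the cardinality of its neighbor set). -/
noncomputable def degN {V : Type*} (G : SimpleGraph V) (v : V) : ℕ :=
  (G.neighborSet v).ncard

/-- A linear forest: an acyclic graph all of whose vertices have degree at most `2`,
i.e. a forest whose connected components are paths and isolated vertices. -/
def IsLinearForest {V : Type*} (H : SimpleGraph V) : Prop :=
  H.IsAcyclic ∧ ∀ v, degN H v ≤ 2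

/-- `G` is `𝓛ₖ`-free: it contains no linear forest with exactly `k` edges as a subgraph. -/
def LinearForestFree {V : Type*} (k : ℕ) (G : SimpleGraph V) : Prop :=
  ∀ H : SimpleGraph V, H ≤ G → IsLinearForest H → H.edgeSet.ncard ≠ k

/-- `Nr r G` is the number of `r`-cliques of `G`. -/
noncomputable def Nr {V : Type*} (r : ℕ) (G : SimpleGraph V) : ℕ :=
  {s : Finset V | G.IsNClique r s}.ncard

/-- `hr r n k a = C(k-a, r) + (n-k+a) * C(a, r-1)` (as an integer). -/
def hr (r n k a : ℕ) : ℤ :=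
  (Nat.choose (k - a) r : ℤ) + ((n : ℤ) - (k : ℤ) + (a : ℤ)) * (Nat.choose a (r - 1) : ℤ)

/-- The graph `H(n,k,a)`: vertices `0,…,a-1` form the set `A`, vertices `a,…,k-a-1` form
the set `B`, the remaining `n-k+a` vertices form the set `C`; the edges are all edges inside
`A ∪ B` together with all edges between `A` and `C`. -/
def HGraph (n k a : ℕ) : SimpleGraph (Fin n) :=
  SimpleGraph.fromRel (fun u v => (u : ℕ) < a ∨ ((u : ℕ) < k - a ∧ (v : ℕ) < k - a))

/-- `H⁺(n,k,a)`: the graph `H(n,k,a)` with one extra edge inside `C`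
(between the first two vertices of `C`). -/
def HplusGraph (n k a : ℕ) : SimpleGraph (Fin n) :=
  SimpleGraph.fromRel (fun u v => (u : ℕ) < a ∨ ((u : ℕ) < k - a ∧ (v : ℕ) < k - a)
    ∨ ((u : ℕ) = k - a ∧ (v : ℕ) = k - a + 1))

/-- `H⁺⁺(n,k,a)`: the graph `H(n,k,a)` with two extra independent edges inside `C`. -/
def HplusplusGraph (n k a : ℕ) : SimpleGraph (Fin n) :=
  SimpleGraph.fromRel (fun u v => (u : ℕ) < a ∨ ((u : ℕ) < k - a ∧ (v : ℕ) < k - a)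
    ∨ ((u : ℕ) = k - a ∧ (v : ℕ) = k - a + 1)
    ∨ ((u : ℕ) = k - a + 2 ∧ (v : ℕ) = k - a + 3))

/-- `G` is isomorphic to a subgraph of `H`. -/
def IsoSubgraph {V W : Type*} (G : SimpleGraph V) (H : SimpleGraph W) : Prop :=
  ∃ f : V ↪ W, ∀ u v, G.Adj u v → H.Adj (f u) (f v)

namespace SimpleGraph

variable {V : Type*} {H : SimpleGraph V}

lemma Adj.eq_of_degree_le_one {x y z : V} [Fintype (H.neighborSet x)]
    (hx : H.degree x ≤ 1) (hy : H.Adj x y) (hz : H.Adj x z) : y = z :=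
  Finset.card_le_one.mp hx y (by simpa using hy) z (by simpa using hz)

lemma Adj.eq_of_degree_le_two {x y z w : V} [Fintype (H.neighborSet x)]
    (hx : H.degree x ≤ 2) (hy : H.Adj x y) (hz : H.Adj x z) (hw : H.Adj x w)
    (hzy : z ≠ y) (hwy : w ≠ y) : z = w := by
  classical
  by_contra hne
  have hsub : ({y, z, w} : Finset V) ⊆ H.neighborFinset x := by
    intro a ha
    simp only [Finset.mem_insert, Finset.mem_singleton] at ha
    rcases ha with rfl | rfl | rfl <;> simpa
  have hcard := Finset.card_le_card hsub
  rw [Finset.card_eq_three.mpr ⟨y, z, w, hzy.symm, hwy.symm, hne, rfl⟩,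
    card_neighborFinset_eq_degree] at hcard
  omega

/-- In a graph of maximum degree at most `2`, two paths that begin with the same edge and end at
vertices of degree at most `1` end at the same vertex. -/
lemma Walk.IsPath.end_eq_of_degree_le [H.LocallyFinite] (hH : ∀ v, H.degree v ≤ 2)
    {x v w y : V} (p : H.Walk x v) (q : H.Walk x w) (h : H.Adj y x)
    (hp : (Walk.cons h p).IsPath) (hq : (Walk.cons h q).IsPath)
    (hv : H.degree v ≤ 1) (hw : H.degree w ≤ 1) : v = w := by
  induction p generalizing y with
  | nil =>
    cases q with
    | nil => rfl
    | cons h' q =>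
      have := Adj.eq_of_degree_le_one hv h.symm h'
      simp_all [Walk.cons_isPath_iff]
  | cons h₁ p ih =>
    have hy₁ := (Walk.cons_isPath_iff _ _).mp hp
    have hy₂ := (Walk.cons_isPath_iff _ _).mp hq
    cases q with
    | nil =>
      have := Adj.eq_of_degree_le_one hw h.symm h₁
      simp_all
    | cons h₂ q =>
      have hne₁ := ne_of_mem_of_not_mem
        (List.mem_cons_of_mem _ p.start_mem_support) hy₁.2
      have hne₂ := ne_of_mem_of_not_mem
        (List.mem_cons_of_mem _ q.start_mem_support) hy₂.2
      obtain rfl := Adj.eq_of_degree_le_two (hH _) h.symm h₁ h₂ hne₁ hne₂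
      exact ih q h₁ hy₁.1 hy₂.1 hv

lemma Reachable.eq_of_degree_le [H.LocallyFinite] (hH : ∀ v, H.degree v ≤ 2)
    {u v w : V} (huv : H.Reachable u v) (huw : H.Reachable u w) (hu : H.degree u ≤ 1)
    (hv : H.degree v ≤ 1) (hw : H.degree w ≤ 1) (hne : u ≠ v) (hne' : u ≠ w) : v = w := by
  obtain ⟨p, hp⟩ := huv.exists_isPath
  obtain ⟨q, hq⟩ := huw.exists_isPath
  cases p with
  | nil => exact absurd rfl hne
  | cons h₁ p =>
    cases q with
    | nil => exact absurd rfl hne'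
    | cons h₂ q =>
      obtain rfl := Adj.eq_of_degree_le_one hu h₁ h₂
      exact Walk.IsPath.end_eq_of_degree_le hH p q h₁ hp hq hv hw

lemma Reachable.degree_pos_of_ne {u v : V} [Fintype (H.neighborSet u)] (h : H.Reachable u v)
    (hne : u ≠ v) : 0 < H.degree u := by
  obtain ⟨p⟩ := h
  cases p with
  | nil => exact absurd rfl hne
  | cons h _ => exact (H.degree_pos_iff_exists_adj u).mpr ⟨_, h⟩

lemma degree_sup_edge_le [Fintype V] {u v : V} [DecidableRel H.Adj]
    [DecidableRel (H ⊔ edge u v).Adj] (hH : ∀ x, H.degree x ≤ 2)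
    (hu : H.degree u ≤ 1) (hv : H.degree v ≤ 1) (x : V) : (H ⊔ edge u v).degree x ≤ 2 := by
  classical
  have key (a : V) (ha : H.degree x ≤ 1)
      (hsub : (H ⊔ edge u v).neighborFinset x ⊆ insert a (H.neighborFinset x)) :
      (H ⊔ edge u v).degree x ≤ 2 := by
    have h₁ := Finset.card_le_card hsub
    have h₂ := Finset.card_insert_le a (H.neighborFinset x)
    simp only [card_neighborFinset_eq_degree] at h₁ h₂
    omega
  by_cases hxu : x = u
  · subst hxu
    refine key v hu fun y hy => ?_
    simp only [mem_neighborFinset, sup_adj, edge_adj, Finset.mem_insert] at hy ⊢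
    grind
  by_cases hxv : x = v
  · subst hxv
    refine key u hv fun y hy => ?_
    simp only [mem_neighborFinset, sup_adj, edge_adj, Finset.mem_insert] at hy ⊢
    grind
  refine le_trans (Finset.card_le_card fun y hy => ?_) (hH x)
  simp only [mem_neighborFinset, sup_adj, edge_adj] at hy ⊢
  grind

end SimpleGraph

lemma degN_eq_degree {V : Type*} (G : SimpleGraph V) (v : V) [Fintype (G.neighborSet v)] :
    degN G v = G.degree v := by
  rw [degN, Set.ncard_eq_toFinset_card', ← card_neighborFinset_eq_degree, neighborFinset]

lemma ncard_edgeSet_eq {V : Type*} (G : SimpleGraph V) [Fintype G.edgeSet] :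
    G.edgeSet.ncard = G.edgeFinset.card := by
  rw [← coe_edgeFinset, Set.ncard_coe_finset]

lemma exists_isLinearForest_forall_card_le {V : Type*} [Fintype V] (G : SimpleGraph V) :
    ∃ H ≤ G, IsLinearForest H ∧
      ∀ K ≤ G, IsLinearForest K → K.edgeSet.ncard ≤ H.edgeSet.ncard := by
  obtain ⟨H, hH, hmax⟩ := Set.exists_max_image {H | H ≤ G ∧ IsLinearForest H}
    (fun H => H.edgeSet.ncard) (Set.toFinite _)
    ⟨⊥, bot_le, isAcyclic_bot, fun v => by simp [degN]⟩
  exact ⟨H, hH.1, hH.2, fun K hK hK' => hmax K ⟨hK, hK'⟩⟩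

open Classical in
/-- If `H` is a maximum linear forest of `G`, an edge of `G` between two vertices of `H`-degree at
most `1` joins the two ends of a component of `H`. -/
lemma reachable_of_adj_of_degree_le_one {V : Type*} [Fintype V] {G H : SimpleGraph V}
    (hle : H ≤ G) (hH : IsLinearForest H)
    (hmax : ∀ K ≤ G, IsLinearForest K → K.edgeSet.ncard ≤ H.edgeSet.ncard) {u v : V}
    (hG : G.Adj u v) (hu : H.degree u ≤ 1) (hv : H.degree v ≤ 1) :
    H.Reachable u v := by
  by_contra hr
  have hnadj : ¬ H.Adj u v := fun h => hr h.reachable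
  have hdeg (x : V) : H.degree x ≤ 2 := degN_eq_degree H x ▸ hH.2 x
  have h := hmax (H ⊔ edge u v) (sup_le hle ((edge_le_iff _).mpr (.inr hG)))
    ⟨hH.1.sup_edge_of_not_reachable hr, fun x => by
      rw [degN_eq_degree]; exact degree_sup_edge_le hdeg hu hv x⟩
  rw [ncard_edgeSet_eq, ncard_edgeSet_eq, card_edgeFinset_sup_edge _ hnadj hG.ne] at h
  omega

open Classical in
lemma card_edgeFinset_le_of_maximum_isLinearForest {V : Type*} [Fintype V] {G H : SimpleGraph V}
    {Δ : ℕ} (hΔ : 3 ≤ Δ) (hdeg : ∀ v, G.degree v ≤ Δ) (hle : H ≤ G) (hH : IsLinearForest H)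
    (hmax : ∀ K ≤ G, IsLinearForest K → K.edgeSet.ncard ≤ H.edgeSet.ncard) :
    G.edgeFinset.card ≤ H.edgeFinset.card * (Δ - 1) := by
  have hH2 (x : V) : H.degree x ≤ 2 := degN_eq_degree H x ▸ hH.2 x
  let C : SimpleGraph V :=
    { Adj := fun u v => G.Adj u v ∧ H.degree u ≤ 1 ∧ H.degree v ≤ 1 ∧ ¬ H.Adj u v
      symm := ⟨fun _ _ h => ⟨h.1.symm, h.2.2.1, h.2.1, fun h' => h.2.2.2 h'.symm⟩⟩
      loopless := ⟨fun _ h => h.1.ne rfl⟩ }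
  have hreach {u v : V} (h : C.Adj u v) : H.Reachable u v :=
    reachable_of_adj_of_degree_le_one hle hH hmax h.1 h.2.1 h.2.2.1
  set I := Finset.univ.filter fun v => H.degree v = 2
  set E := Finset.univ.filter fun v => H.degree v = 1
  have hC : 2 * C.edgeFinset.card ≤ E.card := by
    rw [← sum_degrees_eq_twice_card_edges, Finset.card_filter]
    refine Finset.sum_le_sum fun v _ => ?_
    by_cases h0 : C.degree v = 0
    · simp [h0]
    obtain ⟨w, hw⟩ := (C.degree_pos_iff_exists_adj v).mp (Nat.pos_of_ne_zero h0)
    have hpos := (hreach hw).degree_pos_of_ne hw.ne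
    rw [if_pos (le_antisymm hw.2.1 hpos)]
    refine Finset.card_le_one.mpr fun a ha b hb => ?_
    rw [mem_neighborFinset] at ha hb
    exact (hreach ha).eq_of_degree_le hH2 (hreach hb) ha.2.1 ha.2.2.1 hb.2.2.1 ha.ne hb.ne
  have hL : 2 * H.edgeFinset.card = 2 * I.card + E.card := by
    rw [← sum_degrees_eq_twice_card_edges, Finset.card_filter, Finset.card_filter, Finset.mul_sum,
      ← Finset.sum_add_distrib]
    refine Finset.sum_congr rfl fun v _ => ?_
    have := hH2 v
    interval_cases H.degree v <;> simp
  have hsub : G.edgeFinset ⊆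
      H.edgeFinset ∪ (I.biUnion (fun v => (G \ H).incidenceFinset v) ∪ C.edgeFinset) := by
    intro e he
    induction e with | _ u v =>
    simp only [Finset.mem_union, Finset.mem_biUnion, mem_edgeFinset, mem_edgeSet,
      mem_incidenceFinset, mk'_mem_incidenceSet_iff, sdiff_adj, I, Finset.mem_filter,
      Finset.mem_univ, true_and] at he ⊢
    have hu := hH2 u
    have hv := hH2 v
    by_cases hadj : H.Adj u v
    · exact .inl hadj
    right
    by_cases hu2 : H.degree u = 2
    · exact .inl ⟨u, hu2, ⟨he, hadj⟩, .inl rfl⟩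
    by_cases hv2 : H.degree v = 2
    · exact .inl ⟨v, hv2, ⟨he, hadj⟩, .inr rfl⟩
    exact .inr ⟨he, by omega, by omega, hadj⟩
  have hI : (I.biUnion fun v => (G \ H).incidenceFinset v).card ≤ I.card * (Δ - 2) := by
    refine Finset.card_biUnion_le_card_mul _ _ _ fun v hv => ?_
    have hv2 : H.degree v = 2 := by simpa [I] using hv
    have hnb : H.neighborFinset v ⊆ G.neighborFinset v := fun w hw => by
      simp only [mem_neighborFinset] at hw ⊢
      exact hle hw
    rw [card_incidenceFinset_eq_degree, ← card_neighborFinset_eq_degree, neighborFinset_sdiff,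
      Finset.card_sdiff_of_subset hnb, card_neighborFinset_eq_degree,
      card_neighborFinset_eq_degree, hv2]
    exact Nat.sub_le_sub_right (hdeg v) 2
  have h₁ := Finset.card_le_card hsub
  have h₂ := Finset.card_union_le H.edgeFinset
    (I.biUnion (fun v => (G \ H).incidenceFinset v) ∪ C.edgeFinset)
  have h₃ := Finset.card_union_le (I.biUnion fun v => (G \ H).incidenceFinset v) C.edgeFinset
  obtain ⟨d, rfl⟩ := Nat.exists_eq_add_of_le hΔ
  have e₁ : 3 + d - 1 = d + 2 := by omega
  have e₂ : 3 + d - 2 = d + 1 := by omega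
  rw [e₁]
  rw [e₂] at hI
  nlinarith [Nat.zero_le (E.card * d)]

/-- For `k ≥ 1` and `Δ ≥ 3`, a graph with maximum degree at most `Δ` each of
whose linear-forest subgraphs has at most `k` edges has at most `k(Δ-1)` edges. -/
theorem statement14 {V : Type*} [Fintype V] (G : SimpleGraph V) (k Δ : ℕ)
    (hk : 1 ≤ k) (hΔ : 3 ≤ Δ) (hdeg : ∀ v, degN G v ≤ Δ)
    (hfree : ∀ H : SimpleGraph V, H ≤ G → IsLinearForest H → H.edgeSet.ncard ≤ k) :
    G.edgeSet.ncard ≤ k * (Δ - 1) := by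
  classical
  obtain ⟨H, hle, hH, hmax⟩ := exists_isLinearForest_forall_card_le G
  have hG := card_edgeFinset_le_of_maximum_isLinearForest hΔ
    (fun v => degN_eq_degree G v ▸ hdeg v) hle hH hmax
  rw [← ncard_edgeSet_eq, ← ncard_edgeSet_eq] at hG
  exact hG.trans (Nat.mul_le_mul_right _ (hfree H hle hH))
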